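/- Consider the quadratic form f(x, y) = a x² + 2 b x y + d y² with a > 0, d > 0, b² − a d > 0, and a, |b|, d ≤ C for an absolute constant C. Let λ_± = (a + d ± √((a − d)² + 4 b²))/2 be the eigenvalues of the associated symmetric matrix ((a, b), (b, d)) (so λ₋ < 0). Let X₁, X₂ be independent N(0, 1) random variables. Then there exist constants C', c > 0 depending only on C such that for all t ≥ C', P(f(X₁, X₂) ≤ −t) ≥ c √(−λ₋/t) · e^{t/λ₋} · e^{λ₊/λ₋}. -/

import Mathlib

open MeasureTheory ProbabilityTheory Real

noncomputable section

/-- Larger eigenvalue of the symmetric matrix `((a, b), (b, d))`. -/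
def lamPlus (a b d : ℝ) : ℝ := (a + d + Real.sqrt ((a - d) ^ 2 + 4 * b ^ 2)) / 2

/-- Smaller eigenvalue of the symmetric matrix `((a, b), (b, d))`. -/
def lamMinus (a b d : ℝ) : ℝ := (a + d - Real.sqrt ((a - d) ^ 2 + 4 * b ^ 2)) / 2

set_option maxHeartbeats 1000000

lemma gauss_Icc (x0 : ℝ) :
    (√(2 * π))⁻¹ * Real.exp (-(5 / 4 * x0 ^ 2 + 5 / 4) / 2) ≤
      (gaussianReal 0 1 (Set.Icc (x0 - 1 / 2) (x0 + 1 / 2))).toReal := by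
  have h0 : (0 : ℝ) ≤ (√(2 * π))⁻¹ * Real.exp (-(5 / 4 * x0 ^ 2 + 5 / 4) / 2) := by positivity
  rw [← ENNReal.ofReal_le_iff_le_toReal (measure_ne_top _ _)]
  rw [gaussianReal_apply 0 one_ne_zero]
  calc ENNReal.ofReal ((√(2 * π))⁻¹ * Real.exp (-(5 / 4 * x0 ^ 2 + 5 / 4) / 2))
      = ∫⁻ _ in Set.Icc (x0 - 1 / 2) (x0 + 1 / 2),
          ENNReal.ofReal ((√(2 * π))⁻¹ * Real.exp (-(5 / 4 * x0 ^ 2 + 5 / 4) / 2)) := by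
        rw [setLIntegral_const, Real.volume_Icc]
        norm_num
    _ ≤ _ := by
        apply setLIntegral_mono' measurableSet_Icc
        intro x hx
        rw [gaussianPDF]
        apply ENNReal.ofReal_le_ofReal
        rw [gaussianPDFReal]
        simp only [NNReal.coe_one, mul_one, sub_zero]
        gcongr
        have h1 := hx.1
        have h2 := hx.2
        nlinarith [sq_nonneg (x - x0 - x0 / 4)]

/-- Spectral decomposition of the quadratic form. -/
lemma spectral (a b d l L : ℝ) (hb : b ≠ 0) (hL : L = a + d - l)
    (hchar : (l - a) * (l - d) = b ^ 2) :
    ∃ p q : ℝ, p ^ 2 + q ^ 2 = 1 ∧ ∀ x y : ℝ,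
      a * x ^ 2 + 2 * b * x * y + d * y ^ 2 =
        L * (q * x - p * y) ^ 2 + l * (p * x + q * y) ^ 2 := by
  have hN : 0 < b ^ 2 + (l - a) ^ 2 := by positivity
  set N := b ^ 2 + (l - a) ^ 2 with hNdef
  have hs : √N ^ 2 = N := Real.sq_sqrt hN.le
  have hs0 : √N ≠ 0 := (Real.sqrt_pos.2 hN).ne'
  refine ⟨b / √N, (l - a) / √N, ?_, ?_⟩
  · rw [div_pow, div_pow, hs, ← add_div, ← hNdef, div_self hN.ne']
  · intro x y
    have e : L * ((l - a) / √N * x - b / √N * y) ^ 2 + l * (b / √N * x + (l - a) / √N * y) ^ 2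
        = (L * ((l - a) * x - b * y) ^ 2 + l * (b * x + (l - a) * y) ^ 2) / N := by
      nth_rewrite 5 [← hs]
      field_simp
    rw [e, eq_div_iff hN.ne', hNdef, hL]
    linear_combination ((l - a) * x ^ 2 - 2 * b * x * y - (l - a) * y ^ 2) * hchar

/-- **Lemma F.3**: consider the quadratic form `f(x,y) = ax² + 2bxy + dy²` with `a, d > 0`,
`b² - ad > 0`, and `a, |b|, d ≤ Cb` for a constant `Cb`.  Let `X₁, X₂` be independent
standard Gaussians (their joint law is the product measure).  There exist constants
`C', c > 0` depending only on `Cb` such that for all `t ≥ C'`,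
`P(f(X₁, X₂) ≤ -t) ≥ c √(-λ₋/t) e^{t/λ₋} e^{λ₊/λ₋}`. -/
theorem stmt18 (Cb : ℝ) (hCb : 0 < Cb) :
    ∃ C' > (0 : ℝ), ∃ c > (0 : ℝ),
      ∀ a b dd : ℝ, 0 < a → 0 < dd → a * dd < b ^ 2 →
        a ≤ Cb → |b| ≤ Cb → dd ≤ Cb →
        ∀ t : ℝ, C' ≤ t →
          c * Real.sqrt (-(lamMinus a b dd) / t) *
              Real.exp (t / lamMinus a b dd) * Real.exp (lamPlus a b dd / lamMinus a b dd) ≤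
            (((gaussianReal 0 1).prod (gaussianReal 0 1))
              {p : ℝ × ℝ | a * p.1 ^ 2 + 2 * b * p.1 * p.2 + dd * p.2 ^ 2 ≤ -t}).toReal := by
  refine ⟨Cb, hCb, (2 * π)⁻¹ * Real.exp (-5), by positivity, ?_⟩
  intro a b d ha hd hdet haC hbC hdC t ht
  have ht0 : 0 < t := hCb.trans_le ht
  set S := √((a - d) ^ 2 + 4 * b ^ 2) with hS
  have hS2 : S ^ 2 = (a - d) ^ 2 + 4 * b ^ 2 := Real.sq_sqrt (by positivity)
  have hS0 : 0 ≤ S := Real.sqrt_nonneg _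
  have hb : b ≠ 0 := by
    rintro rfl
    nlinarith [mul_pos ha hd]
  have hSgt : a + d < S := by nlinarith
  have hb2 : b ^ 2 ≤ |b| ^ 2 := by rw [sq_abs]
  have hSle : S ≤ a + d + 2 * |b| := by
    have := abs_nonneg b
    nlinarith [mul_pos ha hd, mul_nonneg (add_pos ha hd).le this]
  obtain ⟨l, hl⟩ : ∃ l, l = lamMinus a b d := ⟨_, rfl⟩
  obtain ⟨L, hL⟩ : ∃ L, L = lamPlus a b d := ⟨_, rfl⟩
  rw [← hl, ← hL]
  rw [lamMinus, ← hS] at hl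
  rw [lamPlus, ← hS] at hL
  have hlneg : l < 0 := by rw [hl]; linarith
  have hLpos : 0 < L := by rw [hL]; linarith
  have hlC : -l ≤ Cb := by rw [hl]; linarith
  obtain ⟨p, q, hpq, hf⟩ := spectral a b d l L hb (by rw [hL, hl]; ring)
    (by rw [hl]; linear_combination hS2 / 4)
  have hr : 0 ≤ (t + L) / (-l) := by
    apply div_nonneg <;> linarith
  set s := √((t + L) / (-l)) with hs
  have hs0 : 0 ≤ s := Real.sqrt_nonneg _
  have hs2 : s ^ 2 = (t + L) / (-l) := Real.sq_sqrt hr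
  have hls : l * s ^ 2 = -(t + L) := by
    rw [hs2, div_neg, mul_neg, mul_div_cancel₀ _ hlneg.ne]
  set x0 := (s + 1) * p with hx0
  set y0 := (s + 1) * q with hy0
  have hsub : Set.Icc (x0 - 1 / 2) (x0 + 1 / 2) ×ˢ Set.Icc (y0 - 1 / 2) (y0 + 1 / 2) ⊆
      {p : ℝ × ℝ | a * p.1 ^ 2 + 2 * b * p.1 * p.2 + d * p.2 ^ 2 ≤ -t} := by
    rintro ⟨x, y⟩ ⟨⟨h1, h2⟩, h3, h4⟩
    change a * x ^ 2 + 2 * b * x * y + d * y ^ 2 ≤ -t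
    simp only at h1 h2 h3 h4
    rw [hf]
    obtain ⟨h, hh⟩ : ∃ h, h = x - x0 := ⟨_, rfl⟩
    obtain ⟨k, hk⟩ : ∃ k, k = y - y0 := ⟨_, rfl⟩
    have hh2 : h ^ 2 ≤ 1 / 4 := by nlinarith
    have hk2 : k ^ 2 ≤ 1 / 4 := by nlinarith
    have hsum : (q * h - p * k) ^ 2 + (p * h + q * k) ^ 2 = h ^ 2 + k ^ 2 := by
      linear_combination (h ^ 2 + k ^ 2) * hpq
    have e1 : q * x - p * y = q * h - p * k := by rw [hh, hk, hx0, hy0]; ring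
    have e2 : p * x + q * y = (s + 1) + (p * h + q * k) := by
      rw [hh, hk, hx0, hy0]; linear_combination (s + 1) * hpq
    rw [e1, e2]
    have hu : (q * h - p * k) ^ 2 ≤ 1 := by linarith [sq_nonneg (p * h + q * k)]
    have hw : (p * h + q * k) ^ 2 ≤ 1 := by linarith [sq_nonneg (q * h - p * k)]
    have hv : -1 ≤ p * h + q * k := (abs_le.1 ((sq_le_one_iff_abs_le_one _).1 hw)).1
    have hv2 : s ^ 2 ≤ ((s + 1) + (p * h + q * k)) ^ 2 := by
      apply pow_le_pow_left₀ hs0; linarith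
    have i1 := mul_le_mul_of_nonneg_left hu hLpos.le
    have i2 := mul_le_mul_of_nonpos_left hv2 hlneg.le
    linarith
  have hmono := ENNReal.toReal_mono (measure_ne_top _ _)
    (measure_mono (μ := (gaussianReal 0 1).prod (gaussianReal 0 1)) hsub)
  refine le_trans ?_ hmono
  rw [Measure.prod_prod, ENNReal.toReal_mul]
  refine le_trans ?_ (mul_le_mul (gauss_Icc x0) (gauss_Icc y0) (by positivity) (by positivity))
  have hsq : √(-l / t) ≤ 1 := by
    rw [Real.sqrt_le_left (by norm_num), one_pow, div_le_one ht0]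
    linarith
  have hpi : (√(2 * π))⁻¹ * (√(2 * π))⁻¹ = (2 * π)⁻¹ := by
    rw [← mul_inv, Real.mul_self_sqrt (by positivity)]
  have hexp : Real.exp (t / l) * Real.exp (L / l) = Real.exp (-s ^ 2) := by
    rw [← Real.exp_add, hs2]
    congr 1
    rw [← add_div, div_neg, neg_neg]
  calc _ = (2 * π)⁻¹ * √(-l / t) * (Real.exp (-5) * (Real.exp (t / l) * Real.exp (L / l))) := by
        ring
    _ ≤ (2 * π)⁻¹ * 1 * (Real.exp (-5) * (Real.exp (t / l) * Real.exp (L / l))) := by gcongr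
    _ = (2 * π)⁻¹ * Real.exp (-5 + -s ^ 2) := by rw [hexp, ← Real.exp_add, mul_one]
    _ ≤ (2 * π)⁻¹ * Real.exp (-(5 / 4 * x0 ^ 2 + 5 / 4) / 2 + -(5 / 4 * y0 ^ 2 + 5 / 4) / 2) := by
        refine mul_le_mul_of_nonneg_left (Real.exp_le_exp.2 ?_) (by positivity)
        have : x0 ^ 2 + y0 ^ 2 = (s + 1) ^ 2 := by
          rw [hx0, hy0]; linear_combination (s + 1) ^ 2 * hpq
        nlinarith [sq_nonneg (s - 4)]
    _ = _ := by rw [← hpi, Real.exp_add]; ring
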